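/- Let α, p, m be integers with 0 ≤ p ≤ α, 0 ≤ m ≤ 2p, and m ≤ α + p. Then Σ_{q=0}^{p} C(α-q, p-q) · C(2α-m+1, 2q-m) = 2^{2p-m} C(α+p-m, 2p-m), where C(n,k) denotes the binomial coefficient with the convention C(n,k) = 0 whenever k < 0 or k > n. -/

import Mathlib

/-- Binomial coefficient on the integers, with the convention that `C(n,k) = 0`
whenever `k < 0` or `k > n`. -/
def ichoose (n k : ℤ) : ℤ :=
  if 0 ≤ k ∧ k ≤ n then (n.toNat).choose k.toNat else 0

open Finset PowerSeries in
theorem sum_antidiagonal_even_choose_mul_choose (n k : ℕ) :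
    ∑ x ∈ antidiagonal k,
        (if 2 ∣ x.1 then ((n + x.1 / 2).choose n : ℤ) else 0) * ((2 * n + k + 1).choose x.2 : ℤ)
      = ∑ x ∈ antidiagonal k, ((n + x.1).choose n : ℤ) * ((n + k).choose x.2 : ℤ) := by
  set A : ℤ⟦X⟧ := mk fun j ↦ ((n + j).choose n : ℤ) with hA_def
  have hA : A * (1 - X) ^ (n + 1) = 1 := mk_add_choose_mul_one_sub_pow_eq_one ℤ n
  have hE : A.expand 2 two_ne_zero * (1 - X ^ 2) ^ (n + 1) = 1 := by
    simpa using congrArg (PowerSeries.expand 2 two_ne_zero) hA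
  have hA_expand : A.expand 2 two_ne_zero * (1 + X) ^ (n + 1) = A := by
    calc A.expand 2 two_ne_zero * (1 + X) ^ (n + 1)
        = A.expand 2 two_ne_zero * (1 + X) ^ (n + 1) * (A * (1 - X) ^ (n + 1)) := by
          rw [hA, mul_one]
      _ = A * (A.expand 2 two_ne_zero * ((1 - X) * (1 + X)) ^ (n + 1)) := by
          rw [mul_pow]; ring
      _ = A := by
          rw [show ((1 - X) * (1 + X) : ℤ⟦X⟧) = 1 - X ^ 2 by ring, hE, mul_one]
  have hchoose (N j : ℕ) : coeff j ((1 + X : ℤ⟦X⟧) ^ N) = (N.choose j : ℤ) := by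
    rw [← Polynomial.coeff_one_add_X_pow ℤ N j, ← Polynomial.coeff_coe]
    simp
  have hprod : A.expand 2 two_ne_zero * (1 + X) ^ (2 * n + k + 1) = A * (1 + X) ^ (n + k) := by
    rw [show 2 * n + k + 1 = (n + 1) + (n + k) by ring, pow_add, ← mul_assoc, hA_expand]
  have hcoeff := congrArg (coeff k) hprod
  simpa only [coeff_mul, hchoose, coeff_expand, hA_def, coeff_mk] using hcoeff

open Finset in
theorem sum_antidiagonal_choose_mul_choose (n k : ℕ) :
    ∑ x ∈ antidiagonal k, (n + x.1).choose n * (n + k).choose x.2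
      = 2 ^ k * (n + k).choose k := by
  rw [← Nat.sum_range_choose, ← Nat.sum_antidiagonal_eq_sum_range_succ_mk (fun x ↦ k.choose x.1),
    sum_mul]
  refine sum_congr rfl fun x hx ↦ ?_
  obtain ⟨a, b⟩ := x
  obtain rfl : a + b = k := by simpa using hx
  have h := Nat.choose_mul (n := n + (a + b)) (k := n + a) (s := n) (by omega)
  rw [show n + (a + b) - n = a + b by omega, show n + a - n = a by omega] at h
  rw [← Nat.choose_symm_of_eq_add (show n + (a + b) = (n + a) + b by ring),
    ← Nat.choose_symm_of_eq_add (show n + (a + b) = n + (a + b) by rfl)]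
  linarith

theorem ichoose_natCast (n k : ℕ) : ichoose n k = n.choose k := by
  unfold ichoose
  split_ifs with h
  · simp
  · rw [Nat.choose_eq_zero_of_lt (by omega), Nat.cast_zero]

theorem ichoose_of_neg (n : ℤ) {k : ℤ} (hk : k < 0) : ichoose n k = 0 :=
  if_neg fun h ↦ absurd h.1 (not_le.2 hk)

/-- **Second binomial convolution identity** used in the proof of Lemma `L4.3`:
`Σ_{q=0}^p C(α-q, p-q) C(2α-m+1, 2q-m) = 2^{2p-m} C(α+p-m, 2p-m)`. -/
theorem binomial_convolution_identity_two
    (α p m : ℤ) (hp0 : 0 ≤ p) (hpα : p ≤ α)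
    (hm0 : 0 ≤ m) (hm1 : m ≤ 2 * p) (hm2 : m ≤ α + p) :
    ∑ q ∈ Finset.Icc (0 : ℤ) p,
        ichoose (α - q) (p - q) * ichoose (2 * α - m + 1) (2 * q - m)
      = 2 ^ (2 * p - m).toNat * ichoose (α + p - m) (2 * p - m) := by
  obtain ⟨n, hn⟩ := Int.eq_ofNat_of_zero_le (sub_nonneg.2 hpα)
  obtain ⟨k, hk⟩ := Int.eq_ofNat_of_zero_le (sub_nonneg.2 hm1)
  obtain rfl : α = p + n := by omega
  obtain rfl : m = 2 * p - k := by omega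
  have hrhs : 2 ^ (2 * p - (2 * p - (k : ℤ))).toNat
        * ichoose (p + n + p - (2 * p - k)) (2 * p - (2 * p - k))
      = ∑ x ∈ Finset.HasAntidiagonal.antidiagonal k,
        (if 2 ∣ x.1 then ((n + x.1 / 2).choose n : ℤ) else 0)
          * ((2 * n + k + 1).choose x.2 : ℤ) := by
    rw [sum_antidiagonal_even_choose_mul_choose,
      show p + n + p - (2 * p - (k : ℤ)) = ((n + k : ℕ) : ℤ) by push_cast; ring,
      show 2 * p - (2 * p - (k : ℤ)) = k by ring, ichoose_natCast, Int.toNat_natCast]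
    exact_mod_cast (sum_antidiagonal_choose_mul_choose n k).symm
  rw [hrhs]
  have hneg (q : ℤ) (hq : ichoose (p + n - q) (p - q)
      * ichoose (2 * (p + n) - (2 * p - k) + 1) (2 * q - (2 * p - k)) ≠ 0) :
      0 ≤ 2 * q - (2 * p - k) := by
    by_contra! h
    exact hq (by rw [ichoose_of_neg _ h, mul_zero])
  refine Finset.sum_bij_ne_zero
    (fun q _ _ ↦ ((2 * (p - q)).toNat, (2 * q - (2 * p - k)).toNat)) ?_ ?_ ?_ ?_
  · intro q hq hne
    have := hneg q hne
    simp only [Finset.mem_Icc] at hq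
    simp only [Finset.HasAntidiagonal.mem_antidiagonal]
    omega
  · intro q hq hne q' hq' hne' h
    simp only [Finset.mem_Icc] at hq hq'
    simp only [Prod.mk.injEq] at h
    omega
  · rintro ⟨a, b⟩ hab hne
    obtain ⟨j, rfl⟩ : 2 ∣ a := by
      by_contra h
      simp [h] at hne
    simp only [Finset.HasAntidiagonal.mem_antidiagonal] at hab
    subst hab
    refine ⟨p - j, by simp only [Finset.mem_Icc]; omega, ?_, ?_⟩
    · rw [show p + n - (p - (j : ℤ)) = ((n + j : ℕ) : ℤ) by push_cast; ring,
        show p - (p - (j : ℤ)) = j by ring,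
        show 2 * (p + (n : ℤ)) - (2 * p - ((2 * j + b : ℕ) : ℤ)) + 1
          = ((2 * n + (2 * j + b) + 1 : ℕ) : ℤ) by push_cast; ring,
        show 2 * (p - (j : ℤ)) - (2 * p - ((2 * j + b : ℕ) : ℤ)) = b by push_cast; ring,
        ichoose_natCast, ichoose_natCast, ← Nat.choose_symm_add]
      simpa using hne
    · ext <;> simp only <;> omega
  · intro q hq hne
    have hb := hneg q hne
    simp only [Finset.mem_Icc] at hq
    obtain ⟨j, hj⟩ := Int.eq_ofNat_of_zero_le (sub_nonneg.2 hq.2)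
    obtain ⟨b, hb⟩ := Int.eq_ofNat_of_zero_le hb
    rw [hb, hj, show p + n - q = ((n + j : ℕ) : ℤ) by push_cast; omega,
      show 2 * (p + (n : ℤ)) - (2 * p - k) + 1 = ((2 * n + k + 1 : ℕ) : ℤ) by push_cast; ring,
      ichoose_natCast, ichoose_natCast, show (2 * (j : ℤ)).toNat = 2 * j by omega,
      Int.toNat_natCast, ← Nat.choose_symm_add]
    simp
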